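/- Let ω ∈ Ω̂ be r-homogeneous (r ≥ 3) and let τ be the associated triangular weight on S_ω. Then for every g ∈ G_ω, if h ∈ G_A is the unique element with hg ∈ H_ω and ψ(hg) = (g₁,…,g_q) are the first-level projections in G_{σω}, one has ∑_{i=1}^{q} ∂^τ(g_i) ≤ η_r·(∂^τ(g) + τ₀). -/

import Mathlib

noncomputable section

open Equiv

namespace Spinal

/-- The letter `q` of the alphabet `{1,…,q}` (here `q = m + 2`). -/
def qtop (m : ℕ) : Fin (m + 2) := Fin.last (m + 1)

/-- The letter `1` of the alphabet. -/
def qone (m : ℕ) : Fin (m + 2) := 0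


theorem qone_ne_qtop (m : ℕ) : qone m ≠ qtop m := by
  simp [qone, qtop, Fin.ext_iff]

/-- The action of an alphabet permutation on the first letter of a word. -/
def rootFun (m : ℕ) (a : Equiv.Perm (Fin (m + 2))) :
    List (Fin (m + 2)) → List (Fin (m + 2))
  | [] => []
  | y :: w => a y :: w

theorem rootFun_leftInv (m : ℕ) (a : Equiv.Perm (Fin (m + 2))) (w : List (Fin (m + 2))) :
    rootFun m a.symm (rootFun m a w) = w := by
  cases w <;> simp [rootFun]

/-- The tree automorphism induced by a root permutation. -/
def rootAut (m : ℕ) (a : Equiv.Perm (Fin (m + 2))) : Equiv.Perm (List (Fin (m + 2))) where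
  toFun := rootFun m a
  invFun := rootFun m a.symm
  left_inv w := rootFun_leftInv m a w
  right_inv w := by simpa using rootFun_leftInv m a.symm w

variable {GB : Type*} [Group GB]

/-- The spinal action of `b : G_B` determined by the sequence `ω` of homomorphisms:
at the vertex `q^n 1` the next letter is moved by `ω n b` (0-indexed, so `ω 0` is the
paper's `ω₁`). -/
def spinalFun (m : ℕ) (ω : ℕ → GB →* Equiv.Perm (Fin (m + 2))) (b : GB) :
    ℕ → List (Fin (m + 2)) → List (Fin (m + 2))
  | _, [] => []
  | n, y :: w =>
    if y = qtop m then y :: spinalFun m ω b (n + 1) w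
    else if y = qone m then
      y :: (match w with
            | [] => []
            | z :: w' => ω n b z :: w')
    else y :: w

theorem spinalFun_leftInv (m : ℕ) (ω : ℕ → GB →* Equiv.Perm (Fin (m + 2)))
    (b : GB) (n : ℕ) (w : List (Fin (m + 2))) :
    spinalFun m ω b⁻¹ n (spinalFun m ω b n w) = w := by
  induction w generalizing n with
  | nil => simp [spinalFun]
  | cons y w ih =>
    by_cases h1 : y = qtop m
    · simp [spinalFun, h1, ih]
    · by_cases h2 : y = qone m
      · match w with
        | [] => simp [spinalFun, h1, h2]
        | z :: w' => simp [spinalFun, h1, h2, map_inv, qone_ne_qtop]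
      · simp [spinalFun, h1, h2]

/-- The tree automorphism induced by `b : G_B` via the sequence `ω`. -/
def spinalAut (m : ℕ) (ω : ℕ → GB →* Equiv.Perm (Fin (m + 2))) (b : GB) :
    Equiv.Perm (List (Fin (m + 2))) where
  toFun := spinalFun m ω b 0
  invFun := spinalFun m ω b⁻¹ 0
  left_inv w := spinalFun_leftInv m ω b 0 w
  right_inv w := by simpa using spinalFun_leftInv m ω b⁻¹ 0 w

/-- The canonical generating set `S_ω = A ∪ B_ω` (non-identity induced automorphisms). -/
def genSet (m : ℕ) (GA : Subgroup (Equiv.Perm (Fin (m + 2))))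
    (ω : ℕ → GB →* Equiv.Perm (Fin (m + 2))) : Set (Equiv.Perm (List (Fin (m + 2)))) :=
  ((rootAut m '' (GA : Set (Equiv.Perm (Fin (m + 2))))) ∪
    Set.range fun b : GB => spinalAut m ω b) \ {1}

/-- The spinal group `G_ω`, as a subgroup of the permutation group of the vertex set
of the `(m+2)`-regular rooted tree. -/
def spinalGroup (m : ℕ) (GA : Subgroup (Equiv.Perm (Fin (m + 2))))
    (ω : ℕ → GB →* Equiv.Perm (Fin (m + 2))) : Subgroup (Equiv.Perm (List (Fin (m + 2)))) :=
  Subgroup.closure (genSet m GA ω)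

/-- The defining conditions on the data `(G_A, G_B, ω)` of a spinal group:
`G_A` is a transitive (hence faithful) group of permutations of the alphabet,
every `ω n` is an epimorphism onto `G_A`, and `ω ∈ Ω̂`: from every index on, the kernels
of the remaining homomorphisms cover `G_B` and intersect trivially. -/
structure SpinalData (m : ℕ) (GA : Subgroup (Equiv.Perm (Fin (m + 2))))
    (ω : ℕ → GB →* Equiv.Perm (Fin (m + 2))) : Prop where
  transitive : ∀ i j : Fin (m + 2), ∃ a ∈ GA, a i = j
  range_eq : ∀ n, (ω n).range = GA
  kernels_cover : ∀ i : ℕ, ∀ b : GB, ∃ j, i ≤ j ∧ ω j b = 1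
  kernels_sep : ∀ i : ℕ, ∀ b : GB, (∀ j, i ≤ j → ω j b = 1) → b = 1

/-- Word length of a group element with respect to a set of generators. -/
def wordLength {G : Type*} [Group G] (S : Set G) (g : G) : ℕ :=
  sInf {n | ∃ l : List G, l.length = n ∧ (∀ x ∈ l, x ∈ S) ∧ l.prod = g}

/-- The word growth function `γ_ω` of the spinal group with respect to `S_ω`. -/
def growth (m : ℕ) (GA : Subgroup (Equiv.Perm (Fin (m + 2))))
    (ω : ℕ → GB →* Equiv.Perm (Fin (m + 2))) (n : ℕ) : ℕ :=
  Nat.card {g : Equiv.Perm (List (Fin (m + 2))) //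
    g ∈ spinalGroup m GA ω ∧ wordLength (genSet m GA ω) g ≤ n}

/-- The period growth function `π_ω`: the largest order of an element of word length
at most `n`. -/
def periodGrowth (m : ℕ) (GA : Subgroup (Equiv.Perm (Fin (m + 2))))
    (ω : ℕ → GB →* Equiv.Perm (Fin (m + 2))) (n : ℕ) : ℕ :=
  sSup (orderOf '' {g : Equiv.Perm (List (Fin (m + 2))) |
    g ∈ spinalGroup m GA ω ∧ wordLength (genSet m GA ω) g ≤ n})

/-- Abstract letters for words over `S_ω`: an `A`-letter is (induced by) a permutation
of the alphabet, a `B`-letter is (induced by) an element of `G_B`. -/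
abbrev Letter (m : ℕ) (GB : Type*) := Equiv.Perm (Fin (m + 2)) ⊕ GB

/-- Evaluation of an abstract letter as a tree automorphism. -/
def evalLetter (m : ℕ) (ω : ℕ → GB →* Equiv.Perm (Fin (m + 2))) :
    Letter m GB → Equiv.Perm (List (Fin (m + 2))) :=
  Sum.elim (rootAut m) (spinalAut m ω)

/-- The list of `A`-letters of a word, in order. -/
def aLetters {m : ℕ} {GB : Type*} : List (Letter m GB) → List (Equiv.Perm (Fin (m + 2))) :=
  List.filterMap fun x => match x with
    | Sum.inl a => some a
    | Sum.inr _ => none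

/-- The list of `B`-letters of a word, in order. -/
def bLetters {m : ℕ} {GB : Type*} : List (Letter m GB) → List GB :=
  List.filterMap fun x => match x with
    | Sum.inl _ => none
    | Sum.inr b => some b

/-- A word is reduced if its letters alternate between `A`-letters and `B`-letters and
no letter is the identity. -/
def IsReduced {m : ℕ} (F : List (Letter m GB)) : Prop :=
  List.Chain' (fun x y => x.isLeft ≠ y.isLeft) F ∧
    Sum.inl (1 : Equiv.Perm (Fin (m + 2))) ∉ F ∧ Sum.inr (1 : GB) ∉ F

open scoped Classical in
/-- One step of the (complete, confluent) simple reduction process: prepend a letter to an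
already reduced word and reduce. -/
def reduceStep {m : ℕ} : Letter m GB → List (Letter m GB) → List (Letter m GB)
  | Sum.inl a, [] => if a = 1 then [] else [Sum.inl a]
  | Sum.inr b, [] => if b = 1 then [] else [Sum.inr b]
  | Sum.inl a, Sum.inl a' :: t => if a * a' = 1 then t else Sum.inl (a * a') :: t
  | Sum.inr b, Sum.inr b' :: t => if b * b' = 1 then t else Sum.inr (b * b') :: t
  | Sum.inl a, y :: t => if a = 1 then y :: t else Sum.inl a :: y :: t
  | Sum.inr b, y :: t => if b = 1 then y :: t else Sum.inr b :: y :: t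

/-- The reduced form of a word, obtained by simple reductions. -/
def reduceWord {m : ℕ} (F : List (Letter m GB)) : List (Letter m GB) :=
  F.foldr reduceStep []

open scoped Classical in
/-- The (unreduced) projection of a word, representing an element of the first-level
stabilizer, to the coordinate `i` of the first level: scanning the word from the left
while accumulating the product `g` of the `A`-letters, a `B`-letter `b` contributes the
letter `b` at the coordinate `g(q)` and the letter `ω₁(b)` at the coordinate `g(1)`. -/
def projWord (m : ℕ) (ω0 : GB →* Equiv.Perm (Fin (m + 2))) (i : Fin (m + 2)) :
    List (Letter m GB) → Equiv.Perm (Fin (m + 2)) → List (Letter m GB)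
  | [], _ => []
  | Sum.inl a :: F, g => projWord m ω0 i F (g * a)
  | Sum.inr b :: F, g =>
      ((if g (qtop m) = i then [Sum.inr b] else []) ++
        (if g (qone m) = i then [Sum.inl (ω0 b)] else [])) ++ projWord m ω0 i F g

/-- The list of the `q^r` (reduced) words at level `r` of the depth-`r` decomposition
of a word. -/
def levelWords (m : ℕ) :
    (ℕ → GB →* Equiv.Perm (Fin (m + 2))) → ℕ → List (Letter m GB) →
      List (List (Letter m GB))
  | _, 0, F => [F]
  | ω, r + 1, F =>
      (List.finRange (m + 2)).flatMap fun i =>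
        levelWords m (fun n => ω (n + 1)) r (reduceWord (projWord m (ω 0) i F 1))

/-- `|L_r(F)|`: the total length of level `r` of the depth-`r` decomposition of `F`. -/
def levelLength (m : ℕ) (ω : ℕ → GB →* Equiv.Perm (Fin (m + 2))) (r : ℕ)
    (F : List (Letter m GB)) : ℕ :=
  ((levelWords m ω r F).map List.length).sum

/-- The triangular weight of a letter: `A`-letters have weight `τ₀ = 1 - η^r`; a
`B`-letter `b` has weight `τ_i = η^r + η^(r-i) - 1` where `i` is the smallest (1-based)
index with `ω_i(b) = 1`. -/
def letterWeight (m : ℕ) (ω : ℕ → GB →* Equiv.Perm (Fin (m + 2))) (η : ℝ) (r : ℕ) :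
    Letter m GB → ℝ
  | Sum.inl _ => 1 - η ^ r
  | Sum.inr b => η ^ r + η ^ (r - (sInf {j | ω j b = 1} + 1)) - 1

/-- The total triangular weight of a word. -/
def wordWeight (m : ℕ) (ω : ℕ → GB →* Equiv.Perm (Fin (m + 2))) (η : ℝ) (r : ℕ)
    (F : List (Letter m GB)) : ℝ :=
  (F.map (letterWeight m ω η r)).sum

/-- The weight `∂^τ(g)` of a group element: the least total weight of a word over `S_ω`
representing it. -/
def elemWeight (m : ℕ) (GA : Subgroup (Equiv.Perm (Fin (m + 2))))
    (ω : ℕ → GB →* Equiv.Perm (Fin (m + 2))) (η : ℝ) (r : ℕ)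
    (g : Equiv.Perm (List (Fin (m + 2)))) : ℝ :=
  sInf {x : ℝ | ∃ F : List (Letter m GB),
    (∀ a : Equiv.Perm (Fin (m + 2)), Sum.inl a ∈ F → a ∈ GA) ∧
    (F.map (evalLetter m ω)).prod = g ∧ wordWeight m ω η r F = x}

theorem letterWeight_nonneg (m : ℕ) (ω : ℕ → GB →* Equiv.Perm (Fin (m + 2))) {r : ℕ}
    (hr : 3 ≤ r) {η : ℝ} (hη0 : 0 < η) (hη1 : η < 1)
    (hroot : η ^ r + η ^ (r - 1) + η ^ (r - 2) = 2) (x : Letter m GB) :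
    0 ≤ letterWeight m ω η r x := by
  cases x with
  | inl a =>
    have := pow_le_one₀ (n := r) hη0.le hη1.le
    simp only [letterWeight]
    linarith
  | inr b =>
    have h1 : η ^ (r - 2) ≤ 1 := pow_le_one₀ hη0.le hη1.le
    have h2 : η ^ (r - 1) ≤ η ^ (r - (sInf {j | ω j b = 1} + 1)) :=
      pow_le_pow_of_le_one hη0.le hη1.le (by omega)
    simp only [letterWeight]
    linarith

theorem wordWeight_nonneg (m : ℕ) (ω : ℕ → GB →* Equiv.Perm (Fin (m + 2))) {r : ℕ}
    (hr : 3 ≤ r) {η : ℝ} (hη0 : 0 < η) (hη1 : η < 1)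
    (hroot : η ^ r + η ^ (r - 1) + η ^ (r - 2) = 2) (F : List (Letter m GB)) :
    0 ≤ wordWeight m ω η r F := by
  refine List.sum_nonneg fun x hx => ?_
  obtain ⟨y, -, rfl⟩ := List.mem_map.1 hx
  exact letterWeight_nonneg m ω hr hη0 hη1 hroot y

/-- The triangle inequality for the weights of `B`-letters. -/
theorem letterWeight_mul_le (m : ℕ) (ω : ℕ → GB →* Equiv.Perm (Fin (m + 2))) {r : ℕ}
    (hr : 3 ≤ r) (hkill : ∀ b : GB, ∃ j, j < r ∧ ω j b = 1) {η : ℝ} (hη0 : 0 < η) (hη1 : η < 1)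
    (hroot : η ^ r + η ^ (r - 1) + η ^ (r - 2) = 2) (b c : GB) :
    letterWeight m ω η r (Sum.inr (b * c)) ≤
      letterWeight m ω η r (Sum.inr b) + letterWeight m ω η r (Sum.inr c) := by
  have key : ∀ b : GB, sInf {j | ω j b = 1} ∈ {j | ω j b = 1} := fun b =>
    Nat.sInf_mem ((hkill b).imp fun _ h => h.2)
  have hb := key b
  have hc := key c
  have hle : ∀ j, ω j b = 1 → ω j c = 1 → sInf {j | ω j (b * c) = 1} ≤ j := fun j h1 h2 =>
    Nat.sInf_le (by simp [h1, h2])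
  have hb0 := letterWeight_nonneg m ω hr hη0 hη1 hroot (Sum.inr b)
  simp only [letterWeight] at hb0 ⊢
  generalize sInf {j | ω j b = 1} = k at *
  generalize sInf {j | ω j c = 1} = l at *
  generalize sInf {j | ω j (b * c) = 1} = n at *
  have hanti : ∀ {i j : ℕ}, i ≤ j → η ^ j ≤ η ^ i := fun h =>
    pow_le_pow_of_le_one hη0.le hη1.le h
  have hn : η ^ (r - (n + 1)) ≤ 1 := pow_le_one₀ hη0.le hη1.le
  rcases lt_trichotomy k l with hkl | rfl | hkl
  · have h1 : η ^ (r - 1) ≤ η ^ (r - (k + 1)) := hanti (by omega)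
    have h2 : η ^ (r - 2) ≤ η ^ (r - (l + 1)) := hanti (by omega)
    linarith
  · have h1 : η ^ (r - (n + 1)) ≤ η ^ (r - (k + 1)) := hanti (by have := hle k hb hc; omega)
    linarith
  · have h1 : η ^ (r - 1) ≤ η ^ (r - (l + 1)) := hanti (by omega)
    have h2 : η ^ (r - 2) ≤ η ^ (r - (k + 1)) := hanti (by omega)
    linarith

/-- The contribution of a `B`-letter to the first level shrinks by the factor `η`. -/
theorem letterWeight_shift_le (m : ℕ) (ω : ℕ → GB →* Equiv.Perm (Fin (m + 2))) {r : ℕ}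
    (hkill : ∀ b : GB, ∃ j, j < r ∧ ω j b = 1) {η : ℝ} (hη0 : 0 < η) (hη1 : η < 1) (b : GB)
    {t : ℝ} (ht : t = if ω 0 b = 1 then 0 else 1 - η ^ r) :
    letterWeight m (fun n => ω (n + 1)) η r (Sum.inr b) + t ≤
      η * (letterWeight m ω η r (Sum.inr b) + (1 - η ^ r)) := by
  obtain ⟨j, hjr, hj⟩ := hkill b
  simp only [letterWeight]
  have hring : ∀ e : ℕ, η * (η ^ r + η ^ e - 1 + (1 - η ^ r)) = η ^ (e + 1) := fun e => by ring
  rw [hring, ht]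
  by_cases h0 : ω 0 b = 1
  · have hz : sInf {j | ω j b = 1} = 0 := Nat.sInf_eq_zero.2 (Or.inl h0)
    have h1 : η ^ (r - (sInf {j | ω (j + 1) b = 1} + 1)) ≤ 1 := pow_le_one₀ hη0.le hη1.le
    rw [if_pos h0, hz, show r - (0 + 1) + 1 = r by omega]
    linarith
  · have hmem : sInf {j | ω j b = 1} ∈ {j | ω j b = 1} := Nat.sInf_mem ⟨j, hj⟩
    have hlt : sInf {j | ω j b = 1} < r := (Nat.sInf_le hj).trans_lt hjr
    have hpos : 1 ≤ sInf {j | ω j b = 1} :=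
      Nat.one_le_iff_ne_zero.2 fun hz => h0 (by rw [hz] at hmem; exact hmem)
    have hshift : sInf {j | ω (j + 1) b = 1} + 1 = sInf {j | ω j b = 1} :=
      Nat.sInf_add (p := fun j => ω j b = 1) hpos
    rw [if_neg h0, hshift,
      show r - (sInf {j | ω j b = 1} + 1) + 1 = r - sInf {j | ω j b = 1} by omega]
    linarith

theorem spinalFun_mul (m : ℕ) (ω : ℕ → GB →* Equiv.Perm (Fin (m + 2))) (b c : GB) (n : ℕ)
    (w : List (Fin (m + 2))) :
    spinalFun m ω (b * c) n w = spinalFun m ω b n (spinalFun m ω c n w) := by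
  induction w generalizing n with
  | nil => simp [spinalFun]
  | cons y w ih =>
    by_cases h1 : y = qtop m
    · simp [spinalFun, h1, ih]
    · by_cases h2 : y = qone m
      · cases w <;> simp [spinalFun, h2, qone_ne_qtop]
      · simp [spinalFun, h1, h2]

theorem spinalAut_mul (m : ℕ) (ω : ℕ → GB →* Equiv.Perm (Fin (m + 2))) (b c : GB) :
    spinalAut m ω (b * c) = spinalAut m ω b * spinalAut m ω c :=
  Equiv.ext fun w => spinalFun_mul m ω b c 0 w

theorem spinalAut_inv (m : ℕ) (ω : ℕ → GB →* Equiv.Perm (Fin (m + 2))) (b : GB) :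
    (spinalAut m ω b)⁻¹ = spinalAut m ω b⁻¹ :=
  Equiv.ext fun _ => rfl

theorem spinalFun_shift (m : ℕ) (ω : ℕ → GB →* Equiv.Perm (Fin (m + 2))) (b : GB) (n : ℕ)
    (w : List (Fin (m + 2))) :
    spinalFun m ω b (n + 1) w = spinalFun m (fun k => ω (k + 1)) b n w := by
  induction w generalizing n with
  | nil => simp [spinalFun]
  | cons y w ih => simp only [spinalFun, ih]

/-- The weight of the `B`-letters of a word, each counted together with one `A`-letter. -/
def pairWeight (m : ℕ) (ω : ℕ → GB →* Equiv.Perm (Fin (m + 2))) (η : ℝ) (r : ℕ) :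
    List (Letter m GB) → ℝ
  | [] => 0
  | Sum.inl _ :: F => pairWeight m ω η r F
  | Sum.inr b :: F => letterWeight m ω η r (Sum.inr b) + (1 - η ^ r) + pairWeight m ω η r F

/-- Merging adjacent `B`-letters makes the `B`-letters outnumber the `A`-letters by at
most one, without increasing the weight. -/
theorem exists_pairWeight_le (m : ℕ)
    (ω : ℕ → GB →* Equiv.Perm (Fin (m + 2))) {r : ℕ} (hr : 3 ≤ r)
    (hkill : ∀ b : GB, ∃ j, j < r ∧ ω j b = 1) {η : ℝ} (hη0 : 0 < η) (hη1 : η < 1)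
    (hroot : η ^ r + η ^ (r - 1) + η ^ (r - 2) = 2) (F : List (Letter m GB)) :
    ∃ F' : List (Letter m GB),
      (F'.map (evalLetter m ω)).prod = (F.map (evalLetter m ω)).prod ∧
      (pairWeight m ω η r F' ≤ wordWeight m ω η r F ∨
        (∃ b F'', F' = Sum.inr b :: F'') ∧
          pairWeight m ω η r F' ≤ wordWeight m ω η r F + (1 - η ^ r)) := by
  have hτ : η ^ r ≤ 1 := pow_le_one₀ hη0.le hη1.le
  induction F with
  | nil => exact ⟨[], rfl, Or.inl (by simp [pairWeight, wordWeight])⟩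
  | cons x F ih =>
    obtain ⟨F', hprod, hF'⟩ := ih
    have hcons : wordWeight m ω η r (x :: F) =
        letterWeight m ω η r x + wordWeight m ω η r F := by simp [wordWeight]
    cases x with
    | inl a =>
      refine ⟨Sum.inl a :: F', by simp [hprod], Or.inl ?_⟩
      rw [hcons]
      simp only [pairWeight, letterWeight]
      rcases hF' with h | ⟨-, h⟩ <;> linarith
    | inr b =>
      rcases hF' with h | ⟨⟨c, F'', rfl⟩, h⟩
      · refine ⟨Sum.inr b :: F', by simp [hprod], Or.inr ⟨⟨b, F', rfl⟩, ?_⟩⟩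
        rw [hcons]
        simp only [pairWeight]
        linarith
      · refine ⟨Sum.inr (b * c) :: F'', ?_, Or.inr ⟨⟨b * c, F'', rfl⟩, ?_⟩⟩
        · rw [List.map_cons, List.map_cons, List.prod_cons, List.prod_cons, ← hprod,
            List.map_cons, List.prod_cons, ← mul_assoc]
          exact congrArg (· * _) (spinalAut_mul m ω b c)
        · have := letterWeight_mul_le m ω hr hkill hη0 hη1 hroot b c
          rw [hcons]
          simp only [pairWeight] at h ⊢
          linarith

/-- Every word decomposes on the first level into words whose total weight is controlled
by the pair weight. -/
theorem exists_projections (m : ℕ) (GA : Subgroup (Equiv.Perm (Fin (m + 2))))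
    (ω : ℕ → GB →* Equiv.Perm (Fin (m + 2))) (hrange : (ω 0).range = GA) {r : ℕ}
    (hkill : ∀ b : GB, ∃ j, j < r ∧ ω j b = 1) {η : ℝ} (hη0 : 0 < η) (hη1 : η < 1)
    (F : List (Letter m GB)) :
    ∃ (p : Equiv.Perm (Fin (m + 2))) (W : Fin (m + 2) → List (Letter m GB)),
      (∀ i w, (F.map (evalLetter m ω)).prod (i :: w) =
        p i :: ((W i).map (evalLetter m fun n => ω (n + 1))).prod w) ∧
      (∀ i a, Sum.inl a ∈ W i → a ∈ GA) ∧
      ∑ i, wordWeight m (fun n => ω (n + 1)) η r (W i) ≤ η * pairWeight m ω η r F := by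
  classical
  induction F with
  | nil => exact ⟨1, fun _ => [], by simp, by simp, by simp [pairWeight, wordWeight]⟩
  | cons x F ih =>
    obtain ⟨p, W, hW, hA, hle⟩ := ih
    cases x with
    | inl a =>
      refine ⟨a * p, W, fun i w => ?_, hA, by simpa only [pairWeight] using hle⟩
      simp only [List.map_cons, List.prod_cons, Equiv.Perm.mul_apply, hW]
      rfl
    | inr b =>
      let L : Fin (m + 2) → List (Letter m GB) := fun y =>
        (if y = qtop m then [Sum.inr b] else []) ++
          (if y = qone m then (if ω 0 b = 1 then [] else [Sum.inl (ω 0 b)]) else [])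
      refine ⟨p, fun i => L (p i) ++ W i, fun i w => ?_, fun i a ha => ?_, ?_⟩
      · simp only [List.map_cons, List.prod_cons, Equiv.Perm.mul_apply, hW, List.map_append,
          List.prod_append]
        generalize ((W i).map (evalLetter m fun n => ω (n + 1))).prod w = v
        change spinalFun m ω b 0 (p i :: v) = _
        by_cases h1 : p i = qtop m
        · simp [L, spinalFun, h1, (qone_ne_qtop m).symm, evalLetter, spinalAut, spinalFun_shift]
        · by_cases h2 : p i = qone m
          · by_cases h3 : ω 0 b = 1 <;> cases v <;>
              simp [L, spinalFun, h2, h3, qone_ne_qtop, evalLetter, rootAut, rootFun]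
          · simp [L, spinalFun, h1, h2]
      · rcases List.mem_append.1 ha with h | h
        · have hab : a = ω 0 b := by
            simp only [L] at h
            split_ifs at h <;> simp_all
          rw [hab, ← hrange]
          exact ⟨b, rfl⟩
        · exact hA i a h
      · have hsum : ∑ i, wordWeight m (fun n => ω (n + 1)) η r (L (p i)) =
            letterWeight m (fun n => ω (n + 1)) η r (Sum.inr b) +
              if ω 0 b = 1 then 0 else 1 - η ^ r := by
          rw [Equiv.sum_comp p fun y => wordWeight m (fun n => ω (n + 1)) η r (L y)]
          have hy : ∀ y, wordWeight m (fun n => ω (n + 1)) η r (L y) =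
              (if y = qtop m then letterWeight m (fun n => ω (n + 1)) η r (Sum.inr b) else 0) +
                if y = qone m then (if ω 0 b = 1 then 0 else 1 - η ^ r) else 0 := by
            intro y
            simp only [wordWeight, L, List.map_append, List.sum_append]
            congr 1 <;> split_ifs <;> simp [letterWeight]
          simp only [hy, Finset.sum_add_distrib, Finset.sum_ite_eq', Finset.mem_univ, if_true]
        have happ : ∀ i, wordWeight m (fun n => ω (n + 1)) η r (L (p i) ++ W i) =
            wordWeight m (fun n => ω (n + 1)) η r (L (p i)) +
              wordWeight m (fun n => ω (n + 1)) η r (W i) := fun i => by simp [wordWeight]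
        simp only [happ, Finset.sum_add_distrib, hsum, pairWeight]
        rw [mul_add]
        exact add_le_add (letterWeight_shift_le m ω hkill hη0 hη1 b rfl) hle

theorem rootAut_inv (m : ℕ) (a : Equiv.Perm (Fin (m + 2))) :
    (rootAut m a)⁻¹ = rootAut m a⁻¹ := by
  ext1 w
  cases w <;> rfl

theorem exists_word_of_mem_spinalGroup (m : ℕ) (GA : Subgroup (Equiv.Perm (Fin (m + 2))))
    (ω : ℕ → GB →* Equiv.Perm (Fin (m + 2))) {g : Equiv.Perm (List (Fin (m + 2)))}
    (hg : g ∈ spinalGroup m GA ω) :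
    ∃ F : List (Letter m GB), (∀ a : Equiv.Perm (Fin (m + 2)), Sum.inl a ∈ F → a ∈ GA) ∧
      (F.map (evalLetter m ω)).prod = g := by
  have hcons : ∀ (z : Letter m GB) (y : Equiv.Perm (List (Fin (m + 2)))),
      (∀ a, z = Sum.inl a → a ∈ GA) →
      (∃ F : List (Letter m GB), (∀ a : Equiv.Perm (Fin (m + 2)), Sum.inl a ∈ F → a ∈ GA) ∧
        (F.map (evalLetter m ω)).prod = y) →
      ∃ F : List (Letter m GB), (∀ a : Equiv.Perm (Fin (m + 2)), Sum.inl a ∈ F → a ∈ GA) ∧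
        (F.map (evalLetter m ω)).prod = evalLetter m ω z * y := by
    rintro z y hz ⟨F, hFA, rfl⟩
    refine ⟨z :: F, fun a ha => ?_, by simp⟩
    rcases List.mem_cons.1 ha with h | h
    · exact hz a h.symm
    · exact hFA a h
  induction hg using Subgroup.closure_induction_left with
  | one => exact ⟨[], by simp, rfl⟩
  | mul_left x hx y _ ih =>
    rcases hx with ⟨⟨a, ha, rfl⟩ | ⟨b, rfl⟩, -⟩
    · exact hcons (Sum.inl a) y (fun _ h => Sum.inl.inj h ▸ ha) ih
    · exact hcons (Sum.inr b) y (by simp) ih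
  | inv_mul_cancel x hx y _ ih =>
    rcases hx with ⟨⟨a, ha, rfl⟩ | ⟨b, rfl⟩, -⟩
    · rw [rootAut_inv]
      exact hcons (Sum.inl a⁻¹) y (fun _ h => Sum.inl.inj h ▸ inv_mem ha) ih
    · simp only [spinalAut_inv]
      exact hcons (Sum.inr b⁻¹) y (by simp) ih

/-- η-Shortening: let `ω` be `r`-homogeneous (`r ≥ 3`), `η = η_r` the root in `(0,1)` of
`x^r + x^{r-1} + x^{r-2} - 2`, and `τ` the associated triangular weight. If `g ∈ G_ω`,
`h ∈ G_A` is the element with `h·g ∈ H_ω`, and `g₁, …, g_q` are the first-level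
projections of `h·g` (characterized by `(h·g)(i·w) = i·(g_i w)`), then
`∑ᵢ ∂^τ(g_i) ≤ η_r · (∂^τ(g) + τ₀)`, the weights of the projections being taken with
respect to the shifted sequence `σω`. -/
theorem eta_shortening (m : ℕ) (GA : Subgroup (Equiv.Perm (Fin (m + 2))))
    {GB : Type*} [Group GB] [Finite GB] (ω : ℕ → GB →* Equiv.Perm (Fin (m + 2)))
    (hdata : SpinalData m GA ω) (r : ℕ) (hr : 3 ≤ r)
    (hhom : ∀ i : ℕ, ∀ b : GB, ∃ j, i ≤ j ∧ j < i + r ∧ ω j b = 1)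
    (η : ℝ) (hη0 : 0 < η) (hη1 : η < 1)
    (hroot : η ^ r + η ^ (r - 1) + η ^ (r - 2) = 2)
    (g : Equiv.Perm (List (Fin (m + 2)))) (hg : g ∈ spinalGroup m GA ω)
    (h : Equiv.Perm (Fin (m + 2))) (hh : h ∈ GA)
    (gs : Fin (m + 2) → Equiv.Perm (List (Fin (m + 2))))
    (hproj : ∀ (i : Fin (m + 2)) (w : List (Fin (m + 2))),
      (rootAut m h * g) (i :: w) = i :: gs i w) :
    ∑ i : Fin (m + 2), elemWeight m GA (fun n => ω (n + 1)) η r (gs i) ≤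
      η * (elemWeight m GA ω η r g + (1 - η ^ r)) := by
  have hkill : ∀ b : GB, ∃ j, j < r ∧ ω j b = 1 := fun b => by
    obtain ⟨j, -, hjr, hj⟩ := hhom 0 b
    exact ⟨j, by omega, hj⟩
  have hτ : η ^ r ≤ 1 := pow_le_one₀ hη0.le hη1.le
  suffices hle : (∑ i, elemWeight m GA (fun n => ω (n + 1)) η r (gs i)) / η - (1 - η ^ r) ≤
      elemWeight m GA ω η r g by
    rw [sub_le_iff_le_add, div_le_iff₀' hη0] at hle
    exact hle
  obtain ⟨F₀, hF₀A, hF₀⟩ := exists_word_of_mem_spinalGroup m GA ω hg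
  refine le_csInf ⟨_, F₀, hF₀A, hF₀, rfl⟩ ?_
  rintro _ ⟨F, -, hF, rfl⟩
  rw [sub_le_iff_le_add, div_le_iff₀' hη0]
  obtain ⟨F', hprod, hF'⟩ :=
    exists_pairWeight_le m ω hr hkill hη0 hη1 hroot F
  obtain ⟨p, W, hW, hA, hWle⟩ :=
    exists_projections m GA ω (hdata.range_eq 0) hkill hη0 hη1 F'
  have hgs : ∀ i, ((W i).map (evalLetter m fun n => ω (n + 1))).prod = gs i := fun i => by
    ext1 w
    have hiw := hproj i w
    rw [Equiv.Perm.mul_apply, ← hF, ← hprod, hW] at hiw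
    exact (List.cons.inj hiw).2
  calc ∑ i, elemWeight m GA (fun n => ω (n + 1)) η r (gs i)
      ≤ ∑ i, wordWeight m (fun n => ω (n + 1)) η r (W i) := by
        refine Finset.sum_le_sum fun i _ => csInf_le ⟨0, ?_⟩ ⟨W i, hA i, hgs i, rfl⟩
        rintro _ ⟨V, -, -, rfl⟩
        exact wordWeight_nonneg m _ hr hη0 hη1 hroot V
    _ ≤ η * pairWeight m ω η r F' := hWle
    _ ≤ η * (wordWeight m ω η r F + (1 - η ^ r)) := by
        refine mul_le_mul_of_nonneg_left ?_ hη0.le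
        rcases hF' with h | ⟨-, h⟩ <;> linarith

end Spinal
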